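/- For every real α ∈ [0,1] and every integer ρ ≥ 2, there exist a finite non-bipartite simple graph G = (V,E), a set S ⊆ V such that G∖S is bipartite and the contraction G/S is non-bipartite with odd girth 2ρ−1, a weight function w : V → ℝ≥0 with w(V) = 2, and a dual certificate y for w with y(E[S]) = α (E[S] the edges inside S), such that w(S) + OPT(G∖S, w) = ((1 + 1/ρ)(1 − α) + 2α) · OPT(G, w). -/

import Mathlib

open Finset

/-- `C` is a vertex cover of `G`. -/
def IsVC {V : Type*} (G : SimpleGraph V) (C : Finset V) : Prop :=
  ∀ ⦃u v : V⦄, G.Adj u v → u ∈ C ∨ v ∈ C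

/-- `OPT G w` : minimum weight of a vertex cover of `G`. -/
noncomputable def OPT {V : Type*} [Fintype V] (G : SimpleGraph V) (w : V → ℝ) : ℝ :=
  sInf {t : ℝ | ∃ C : Finset V, IsVC G C ∧ t = ∑ v ∈ C, w v}

/-- `LPval G w` : optimal value of the standard vertex cover LP relaxation. -/
noncomputable def LPval {V : Type*} [Fintype V] (G : SimpleGraph V) (w : V → ℝ) : ℝ :=
  sInf {t : ℝ | ∃ x : V → ℝ, (∀ v, 0 ≤ x v) ∧ (∀ ⦃u v : V⦄, G.Adj u v → 1 ≤ x u + x v) ∧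
    t = ∑ v, w v * x v}

/-- The graph `G ∖ S` (vertices of `S` kept as isolated vertices). -/
def Gdel {V : Type*} (G : SimpleGraph V) (S : Set V) : SimpleGraph V :=
  SimpleGraph.fromRel (fun u v => G.Adj u v ∧ u ∉ S ∧ v ∉ S)

open scoped Classical in
/-- Sum of `y` over the set of edges described by `P`. -/
noncomputable def ysum {V : Type*} [Fintype V] [DecidableEq V]
    (y : Sym2 V → ℝ) (P : Sym2 V → Prop) : ℝ :=
  ∑ e : Sym2 V, if P e then y e else 0

/-- `y` is a dual certificate for `w` : a feasible dual solution with `y(δ(v)) = w v`. -/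
def IsDualCert {V : Type*} [Fintype V] [DecidableEq V] (G : SimpleGraph V)
    (w : V → ℝ) (y : Sym2 V → ℝ) : Prop :=
  (∀ e, 0 ≤ y e) ∧ (∀ e, e ∉ G.edgeSet → y e = 0) ∧
    ∀ v : V, ysum y (fun e => e ∈ G.edgeSet ∧ v ∈ e) = w v

/-- Membership in the polytope `Q^W`. -/
def memQW {V : Type*} [Fintype V] [DecidableEq V] (G : SimpleGraph V) (w : V → ℝ) : Prop :=
  (∀ v, 0 ≤ w v) ∧ (∑ v, w v) = 2 ∧ ∃ y : Sym2 V → ℝ, IsDualCert G w y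

/-- `G` has odd girth `n` : it contains an odd cycle of length `n` and no shorter one. -/
def HasOddGirth {V : Type*} (G : SimpleGraph V) (n : ℕ) : Prop :=
  Odd n ∧ (∃ (v : V) (c : G.Walk v v), c.IsCycle ∧ c.length = n) ∧
    ∀ (v : V) (c : G.Walk v v), c.IsCycle → Odd c.length → n ≤ c.length

/-- The contraction `G / S` of the vertex set `S` to a single new vertex `none`. -/
def contract {V : Type*} (G : SimpleGraph V) (S : Set V) :
    SimpleGraph (Option {v : V // v ∉ S}) :=
  SimpleGraph.fromRel (fun x y =>
    match x, y with
    | some u, some v => G.Adj u.1 v.1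
    | some u, none => ∃ s ∈ S, G.Adj u.1 s
    | none, _ => False)

/-- `I` is an independent set of `G`. -/
def IsIndep {V : Type*} (G : SimpleGraph V) (I : Finset V) : Prop :=
  ∀ ⦃u⦄, u ∈ I → ∀ ⦃v⦄, v ∈ I → ¬ G.Adj u v

/-- The fractional chromatic number of `G`. -/
noncomputable def fracChrom {V : Type*} [Fintype V] [DecidableEq V] (G : SimpleGraph V) : ℝ :=
  sInf {t : ℝ | ∃ y : Finset V → ℝ, (∀ I, 0 ≤ y I) ∧ (∀ I, ¬ IsIndep G I → y I = 0) ∧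
    (∀ v : V, 1 ≤ ∑ I : Finset V, if v ∈ I then y I else 0) ∧ t = ∑ I : Finset V, y I}

def TG (k : ℕ) : SimpleGraph (Fin (2*(k+3))) where
  Adj u v := u.1 + 1 = v.1 ∨ v.1 + 1 = u.1 ∨ (u.1 = 2*k+3 ∧ v.1 = 2*k+5) ∨
    (v.1 = 2*k+3 ∧ u.1 = 2*k+5)
  symm := ⟨by intro u v h; omega⟩
  loopless := ⟨by intro u h; omega⟩

lemma TG_adj (k : ℕ) (u v : Fin (2*(k+3))) : (TG k).Adj u v ↔
    (u.1 + 1 = v.1 ∨ v.1 + 1 = u.1 ∨ (u.1 = 2*k+3 ∧ v.1 = 2*k+5) ∨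
    (v.1 = 2*k+3 ∧ u.1 = 2*k+5)) := Iff.rfl

def TS (k : ℕ) : Finset (Fin (2*(k+3))) :=
  Finset.univ.filter (fun v => v.1 = 0 ∨ 2*k+3 ≤ v.1)

lemma mem_TS (k : ℕ) (v : Fin (2*(k+3))) : v ∈ TS k ↔ (v.1 = 0 ∨ 2*k+3 ≤ v.1) := by
  simp [TS]

noncomputable def Tc (k : ℕ) (α : ℝ) (i : ℕ) : ℝ := if i = k+2 then α else (1-α)/((k:ℝ)+2)

noncomputable def Tw (k : ℕ) (α : ℝ) (v : Fin (2*(k+3))) : ℝ := Tc k α (v.1/2)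

def Te (k : ℕ) (i : Fin (k+3)) : Sym2 (Fin (2*(k+3))) :=
  s(⟨2*i.1, by omega⟩, ⟨2*i.1+1, by omega⟩)

noncomputable def Ty (k : ℕ) (α : ℝ) (e : Sym2 (Fin (2*(k+3)))) : ℝ :=
  ∑ i : Fin (k+3), if e = Te k i then Tc k α i.1 else 0

lemma Tc_nonneg (k : ℕ) (α : ℝ) (h0 : 0 ≤ α) (h1 : α ≤ 1) (i : ℕ) : 0 ≤ Tc k α i := by
  unfold Tc
  split_ifs
  · exact h0
  · apply div_nonneg <;> [linarith; positivity]

lemma Tc_last (k : ℕ) (α : ℝ) : Tc k α (k+2) = α := by simp [Tc]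

lemma Tc_lt (k : ℕ) (α : ℝ) (i : ℕ) (h : i < k+2) : Tc k α i = (1-α)/((k:ℝ)+2) := by
  simp [Tc, h.ne]

lemma Tc_sum (k : ℕ) (α : ℝ) : ∑ i ∈ range (k+3), Tc k α i = 1 := by
  rw [sum_range_succ, Tc_last, sum_congr rfl (fun i hi => Tc_lt k α i (mem_range.1 hi))]
  have : (k:ℝ)+2 ≠ 0 := by positivity
  simp
  field_simp
  ring

lemma sum_double (f : ℕ → ℝ) (m : ℕ) :
    ∑ j ∈ range (2*m), f j = ∑ i ∈ range m, (f (2*i) + f (2*i+1)) := by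
  induction m with
  | zero => simp
  | succ m ih =>
    rw [show 2*(m+1) = 2*m+1+1 by ring, sum_range_succ, sum_range_succ, ih, sum_range_succ]
    ring

open scoped Classical in
noncomputable def chi {n : ℕ} (C : Finset (Fin n)) (j : ℕ) : ℝ := if ∃ v ∈ C, v.1 = j then 1 else 0

lemma chi_nonneg {n : ℕ} (C : Finset (Fin n)) (j : ℕ) : 0 ≤ chi C j := by
  unfold chi; split_ifs <;> norm_num

lemma chi_one {n : ℕ} (C : Finset (Fin n)) (j : ℕ) (h : j < n) (hc : (⟨j, h⟩ : Fin n) ∈ C) :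
    chi C j = 1 := by
  unfold chi; rw [if_pos]; exact ⟨_, hc, rfl⟩

lemma chi_zero {n : ℕ} (C : Finset (Fin n)) (j : ℕ) (h : ∀ v ∈ C, v.1 ≠ j) :
    chi C j = 0 := by
  unfold chi; rw [if_neg]; rintro ⟨v, hv, e⟩; exact h v hv e

lemma wsum (k : ℕ) (α : ℝ) (C : Finset (Fin (2*(k+3)))) :
    ∑ v ∈ C, Tw k α v = ∑ i ∈ range (k+3), (chi C (2*i) + chi C (2*i+1)) * Tc k α i := by
  have h1 : ∑ v ∈ C, Tw k α v = ∑ v : Fin (2*(k+3)), chi C v.1 * Tc k α (v.1/2) := by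
    rw [← Finset.sum_subset (subset_univ C)]
    · apply sum_congr rfl
      intro v hv
      rw [chi_one C v.1 v.2 hv, one_mul, Tw]
    · intro v _ hv
      rw [chi_zero, zero_mul]
      intro u hu e
      have := Fin.ext e
      simp_all
  rw [h1, Fin.sum_univ_eq_sum_range (fun j => chi C j * Tc k α (j/2)), sum_double]
  apply sum_congr rfl
  intro i _
  rw [show 2*i/2 = i by omega, show (2*i+1)/2 = i by omega]
  ring

lemma OPT_eq {n : ℕ} (G : SimpleGraph (Fin n)) (w : Fin n → ℝ) (a : ℝ)
    (C : Finset (Fin n)) (hC : IsVC G C) (ha : ∑ v ∈ C, w v = a)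
    (hl : ∀ C, IsVC G C → a ≤ ∑ v ∈ C, w v) : OPT G w = a := by
  apply IsLeast.csInf_eq
  refine ⟨⟨C, hC, ha.symm⟩, ?_⟩
  rintro t ⟨D, hD, rfl⟩
  exact hl D hD

lemma ysum_Ty (k : ℕ) (α : ℝ) (P : Sym2 (Fin (2*(k+3))) → Prop) [DecidablePred P] :
    ysum (Ty k α) P = ∑ i : Fin (k+3), if P (Te k i) then Tc k α i.1 else 0 := by
  unfold ysum Ty
  have : ∀ e : Sym2 (Fin (2*(k+3))), (if P e then (∑ i : Fin (k+3), if e = Te k i then Tc k α i.1 else 0) else 0)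
     = ∑ i : Fin (k+3), if e = Te k i then (if P (Te k i) then Tc k α i.1 else 0) else 0 := by
    intro e
    split_ifs with h
    · apply sum_congr rfl
      intro i _
      by_cases h2 : e = Te k i
      · subst h2; simp [h]
      · simp [h2]
    · symm
      apply sum_eq_zero
      intro i _
      by_cases h2 : e = Te k i
      · subst h2; simp [h]
      · simp [h2]
  trans ∑ e, ∑ i : Fin (k+3), if e = Te k i then (if P (Te k i) then Tc k α i.1 else 0) else 0
  · apply sum_congr rfl
    intro e _
    rw [← this]
    congr
  · rw [sum_comm]
    simp

lemma Te_mem (k : ℕ) (i : Fin (k+3)) : Te k i ∈ (TG k).edgeSet := by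
  rw [Te, SimpleGraph.mem_edgeSet, TG_adj]; simp

lemma dual (k : ℕ) (α : ℝ) (h0 : 0 ≤ α) (h1 : α ≤ 1) : IsDualCert (TG k) (Tw k α) (Ty k α) := by
  classical
  refine ⟨?_, ?_, ?_⟩
  · intro e
    apply sum_nonneg
    intro i _
    split_ifs
    · exact Tc_nonneg k α h0 h1 _
    · exact le_rfl
  · intro e he
    apply sum_eq_zero
    intro i _
    rw [if_neg]
    rintro rfl
    exact he (Te_mem k i)
  · intro v
    rw [ysum_Ty, Finset.sum_eq_single ⟨v.1/2, by omega⟩]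
    · rw [if_pos]
      · rfl
      · refine ⟨Te_mem _ _, ?_⟩
        simp only [Te, Sym2.mem_iff, Fin.ext_iff]
        omega
    · intro i _ hi
      rw [if_neg]
      rintro ⟨_, h⟩
      simp only [Te, Sym2.mem_iff, Fin.ext_iff] at h
      apply hi
      simp only [Fin.ext_iff]
      omega
    · simp

lemma ysumS (k : ℕ) (α : ℝ) : ysum (Ty k α) (fun e => e ∈ (TG k).edgeSet ∧
    ∃ p ∈ TS k, ∃ q ∈ TS k, e = s(p, q)) = α := by
  classical
  rw [ysum_Ty, Finset.sum_eq_single ⟨k+2, by omega⟩]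
  · rw [if_pos]
    · exact Tc_last k α
    · refine ⟨Te_mem _ _, _, ?_, _, ?_, rfl⟩ <;> rw [mem_TS] <;> simp <;> omega
  · intro i _ hi
    rw [if_neg]
    rintro ⟨_, p, hp, q, hq, h⟩
    rw [mem_TS] at hp hq
    rw [Te, Sym2.eq_iff] at h
    have hi' : i.1 ≠ k+2 := fun h => hi (Fin.ext h)
    simp only [Fin.ext_iff] at h
    omega
  · simp

lemma optG (k : ℕ) (α : ℝ) (h0 : 0 ≤ α) (h1 : α ≤ 1) : OPT (TG k) (Tw k α) = 1 := by
  apply OPT_eq _ _ _ (univ.filter (fun v => v.1 % 2 = 1))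
  · intro u v h
    rw [TG_adj] at h
    simp only [mem_filter, mem_univ, true_and]
    omega
  · rw [wsum, ← Tc_sum k α]
    apply sum_congr rfl
    intro i hi
    rw [mem_range] at hi
    rw [chi_zero, chi_one _ _ (by omega)]
    · ring
    · simp
    · intro v hv
      simp only [mem_filter, mem_univ, true_and] at hv
      omega
  · intro C hC
    rw [wsum, ← Tc_sum k α]
    apply sum_le_sum
    intro i hi
    rw [mem_range] at hi
    have := Tc_nonneg k α h0 h1 i
    have h : 1 ≤ chi C (2*i) + chi C (2*i+1) := by
      have a1 := chi_nonneg C (2*i)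
      have a2 := chi_nonneg C (2*i+1)
      rcases hC (Te_mem k ⟨i, hi⟩) with h | h
      · rw [chi_one C _ _ h]; linarith
      · rw [chi_one C _ _ h]; linarith
    nlinarith

lemma wS (k : ℕ) (α : ℝ) : ∑ v ∈ TS k, Tw k α v = 2 * ((1-α)/((k:ℝ)+2)) + 2 * α := by
  rw [wsum, sum_range_succ, sum_range_succ, sum_range_succ', sum_eq_zero]
  · rw [Tc_last, Tc_lt k α 0 (by omega), Tc_lt k α (k+1) (by omega)]
    rw [chi_one _ (2*0) (by omega), chi_zero _ (2*0+1), chi_zero _ (2*(k+1)),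
      chi_one _ (2*(k+1)+1) (by omega), chi_one _ (2*(k+2)) (by omega),
      chi_one _ (2*(k+2)+1) (by omega)]
    · ring
    all_goals simp only [mem_TS]
    all_goals intros
    all_goals first | omega | exact Or.inl trivial
  · intro i hi
    rw [mem_range] at hi
    rw [chi_zero, chi_zero]
    · ring
    all_goals simp only [mem_TS]
    all_goals intros
    all_goals omega

lemma del_adj (k : ℕ) (u v : Fin (2*(k+3))) : (Gdel (TG k) ↑(TS k)).Adj u v ↔
    (u.1 + 1 = v.1 ∨ v.1 + 1 = u.1) ∧ 0 < u.1 ∧ u.1 < 2*k+3 ∧ 0 < v.1 ∧ v.1 < 2*k+3 := by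
  simp only [Gdel, SimpleGraph.fromRel_adj, TG_adj, mem_coe, mem_TS, ne_eq, Fin.ext_iff]
  omega

lemma optDel (k : ℕ) (α : ℝ) (h0 : 0 ≤ α) (h1 : α ≤ 1) :
    OPT (Gdel (TG k) ↑(TS k)) (Tw k α) = (k+1) * ((1-α)/((k:ℝ)+2)) := by
  apply OPT_eq _ _ _ (univ.filter (fun v => v.1 % 2 = 0 ∧ 0 < v.1 ∧ v.1 < 2*k+3))
  · intro u v h
    rw [del_adj] at h
    simp only [mem_filter, mem_univ, true_and]
    omega
  · rw [wsum, sum_range_succ, sum_range_succ', chi_zero _ (2*(k+2)), chi_zero _ (2*(k+2)+1),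
      chi_zero _ (2*0), chi_zero _ (2*0+1)]
    · rw [sum_congr rfl (g := fun _ => (1-α)/((k:ℝ)+2))]
      · simp
      · intro i hi
        rw [mem_range] at hi
        rw [Tc_lt _ _ _ (by omega), chi_one _ _ (by omega), chi_zero]
        · ring
        · intro v
          simp only [mem_filter, mem_univ, true_and]
          omega
        · simp only [mem_filter, mem_univ, true_and]
          omega
    all_goals intro v
    all_goals simp only [mem_filter, mem_univ, true_and]
    all_goals omega
  · intro C hC
    have hd : 0 ≤ (1-α)/((k:ℝ)+2) := by
      apply div_nonneg <;> [linarith; positivity]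
    rw [wsum, sum_range_succ]
    have e1 : ∑ i ∈ range (k+2), (chi C (2*i) + chi C (2*i+1)) * Tc k α i =
        (∑ i ∈ range (k+2), chi C (2*i) + ∑ i ∈ range (k+2), chi C (2*i+1))
          * ((1-α)/((k:ℝ)+2)) := by
      rw [← sum_add_distrib, sum_mul]
      apply sum_congr rfl
      intro i hi
      rw [Tc_lt _ _ _ (mem_range.1 hi)]
    rw [e1, sum_range_succ', sum_range_succ (fun i => chi C (2*i+1))]
    have e2 : (k:ℝ)+1 ≤ ∑ i ∈ range (k+1), chi C (2*(i+1)) + ∑ i ∈ range (k+1), chi C (2*i+1) := by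
      rw [← sum_add_distrib]
      calc (k:ℝ)+1 = ∑ i ∈ range (k+1), (1:ℝ) := by simp
        _ ≤ _ := by
          apply sum_le_sum
          intro i hi
          rw [mem_range] at hi
          have a1 := chi_nonneg C (2*(i+1))
          have a2 := chi_nonneg C (2*i+1)
          have : (Gdel (TG k) ↑(TS k)).Adj ⟨2*i+1, by omega⟩ ⟨2*(i+1), by omega⟩ := by
            rw [del_adj]; simp only; omega
          rcases hC this with h | h
          · rw [chi_one C _ _ h]; linarith
          · rw [chi_one C _ _ h]; linarith
    have b1 := chi_nonneg C (2*0)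
    have b2 := chi_nonneg C (2*(k+1)+1)
    have b3 := chi_nonneg C (2*(k+2))
    have b4 := chi_nonneg C (2*(k+2)+1)
    rw [Tc_last]
    have b5 : 0 ≤ (chi C (2*(k+2)) + chi C (2*(k+2)+1)) * α := by positivity
    have := mul_le_mul_of_nonneg_right (show (k:ℝ)+1 ≤ (∑ i ∈ range (k+1), chi C (2*(i+1)) + chi C (2*0)) + (∑ i ∈ range (k+1), chi C (2*i+1) + chi C (2*(k+1)+1)) by linarith) hd
    linarith

lemma notcol (k : ℕ) : ¬ (TG k).Colorable 2 := by
  rintro ⟨c⟩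
  have a1 := c.valid (v := ⟨2*k+3, by omega⟩) (w := ⟨2*k+4, by omega⟩) (by rw [TG_adj]; simp)
  have a2 := c.valid (v := ⟨2*k+4, by omega⟩) (w := ⟨2*k+5, by omega⟩) (by rw [TG_adj]; simp)
  have a3 := c.valid (v := ⟨2*k+3, by omega⟩) (w := ⟨2*k+5, by omega⟩) (by rw [TG_adj]; simp)
  omega

lemma delcol (k : ℕ) : (Gdel (TG k) ↑(TS k)).Colorable 2 := by
  refine ⟨SimpleGraph.Coloring.mk (fun v => ⟨v.1 % 2, by omega⟩) ?_⟩
  intro u v h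
  rw [del_adj] at h
  simp only [ne_eq, Fin.ext_iff]
  omega

def pos (k : ℕ) : Option {v : Fin (2*(k+3)) // v ∉ (↑(TS k) : Set (Fin (2*(k+3))))} → ℕ
  | none => 0
  | some v => v.1.1

lemma con_adj (k : ℕ) (x y) : (contract (TG k) ↑(TS k)).Adj x y ↔
    (pos k x + 1 = pos k y ∨ pos k y + 1 = pos k x ∨ (pos k x = 0 ∧ pos k y = 2*k+2) ∨
      (pos k y = 0 ∧ pos k x = 2*k+2)) := by
  have key : ∀ u : Fin (2*(k+3)), u ∉ (↑(TS k) : Set (Fin (2*(k+3)))) →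
      ((∃ s ∈ (↑(TS k) : Set (Fin (2*(k+3)))), (TG k).Adj u s) ↔ (u.1 = 1 ∨ u.1 = 2*k+2)) := by
    intro u hu
    simp only [mem_coe, mem_TS] at hu
    constructor
    · rintro ⟨s, hs, h⟩
      rw [TG_adj] at h
      simp only [mem_coe, mem_TS] at hs
      omega
    · rintro (h | h)
      · refine ⟨⟨0, by omega⟩, ?_, ?_⟩
        · simp [mem_TS]
        · rw [TG_adj]; simp only; omega
      · refine ⟨⟨2*k+3, by omega⟩, ?_, ?_⟩
        · simp [mem_TS]
        · rw [TG_adj]; simp only; omega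
  rcases x with _ | ⟨u, hu⟩ <;> rcases y with _ | ⟨v, hv⟩
  · simp [contract, pos]
  · simp only [contract, SimpleGraph.fromRel_adj, key v hv, pos]
    simp only [mem_coe, mem_TS] at hv
    simp
    omega
  · simp only [contract, SimpleGraph.fromRel_adj, key u hu, pos]
    simp only [mem_coe, mem_TS] at hu
    simp
    omega
  · simp only [contract, SimpleGraph.fromRel_adj, pos, TG_adj]
    simp only [mem_coe, mem_TS] at hu hv
    simp only [ne_eq, Option.some.injEq, Subtype.mk.injEq, Fin.ext_iff]
    omega

lemma walk_lift (k : ℕ) {x y} (p : (contract (TG k) ↑(TS k)).Walk x y) :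
    ∃ d m : ℤ, |d| ≤ p.length ∧ (2:ℤ) ∣ d - p.length ∧
      d = (pos k y : ℤ) - pos k x + m * (2*k+3) := by
  induction p with
  | nil => exact ⟨0, 0, by simp, by simp, by simp⟩
  | @cons a b c h p ih =>
    obtain ⟨d, m, h1, h2, h3⟩ := ih
    rw [con_adj] at h
    rw [SimpleGraph.Walk.length_cons, Nat.cast_add, Nat.cast_one]
    rw [abs_le] at h1
    rcases h with h | h | h | h
    · refine ⟨d+1, m, by rw [abs_le]; omega, by omega, by rw [h3]; omega⟩
    · refine ⟨d-1, m, by rw [abs_le]; omega, by omega, by rw [h3]; omega⟩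
    · refine ⟨d-1, m-1, by rw [abs_le]; omega, by omega, ?_⟩
      have : (m-1) * (2*(k:ℤ)+3) = m * (2*k+3) - (2*k+3) := by ring
      rw [this, h3]; omega
    · refine ⟨d+1, m+1, by rw [abs_le]; omega, by omega, ?_⟩
      have : (m+1) * (2*(k:ℤ)+3) = m * (2*k+3) + (2*k+3) := by ring
      rw [this, h3]; omega

def cf (k : ℕ) (i : Fin (2*k+3)) :
    Option {v : Fin (2*(k+3)) // v ∉ (↑(TS k) : Set (Fin (2*(k+3))))} :=
  if h : i.1 = 0 then none else some ⟨⟨i.1, by omega⟩, by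
    simp only [mem_coe, mem_TS]; omega⟩

lemma pos_cf (k : ℕ) (i : Fin (2*k+3)) : pos k (cf k i) = i.1 := by
  unfold cf
  split_ifs with h
  · simp [pos, h]
  · simp [pos]

def ch (k : ℕ) : SimpleGraph.cycleGraph (2*k+3) →g contract (TG k) ↑(TS k) where
  toFun := cf k
  map_rel' := by
    intro a b h
    rw [con_adj, pos_cf, pos_cf]
    rw [SimpleGraph.cycleGraph_adj'] at h
    have := a.2
    have := b.2
    rcases h with h | h
    · rw [Fin.val_sub] at h
      rcases le_or_gt b.1 a.1 with hh | hh
      · rw [show 2*k+3 - b.1 + a.1 = (a.1 - b.1) + (2*k+3) by omega, Nat.add_mod_right,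
          Nat.mod_eq_of_lt (by omega)] at h
        omega
      · rw [Nat.mod_eq_of_lt (by omega)] at h
        omega
    · rw [Fin.val_sub] at h
      rcases le_or_gt a.1 b.1 with hh | hh
      · rw [show 2*k+3 - a.1 + b.1 = (b.1 - a.1) + (2*k+3) by omega, Nat.add_mod_right,
          Nat.mod_eq_of_lt (by omega)] at h
        omega
      · rw [Nat.mod_eq_of_lt (by omega)] at h
        omega

lemma girth (k : ℕ) : HasOddGirth (contract (TG k) ↑(TS k)) (2*k+3) := by
  refine ⟨⟨k+1, by ring⟩, ⟨_, (SimpleGraph.cycleGraph.cycle (2*k)).map (ch k), ?_, ?_⟩, ?_⟩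
  · apply SimpleGraph.Walk.IsCycle.map
    · intro a b h
      have : pos k (cf k a) = pos k (cf k b) := congrArg _ h
      rw [pos_cf, pos_cf] at this
      exact Fin.ext this
    · exact SimpleGraph.cycleGraph.isCycle_cycle
  · rw [SimpleGraph.Walk.length_map, SimpleGraph.cycleGraph.length_cycle]
  · intro v c _ ho
    obtain ⟨d, m, h1, h2, h3⟩ := walk_lift k c
    obtain ⟨r, hr⟩ := ho
    rw [sub_self, zero_add] at h3
    have hd : d ≠ 0 := by omega
    have : (2*(k:ℤ)+3) ≤ |d| := by
      have h4 : (2*(k:ℤ)+3) ∣ |d| := by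
        rw [dvd_abs]; exact ⟨m, by rw [h3]; ring⟩
      exact Int.le_of_dvd (abs_pos.2 hd) h4
    omega

lemma connotcol (k : ℕ) : ¬ (contract (TG k) ↑(TS k)).Colorable 2 := by
  intro h
  rw [SimpleGraph.two_colorable_iff_forall_loop_even] at h
  obtain ⟨ho, ⟨v, c, _, hc⟩, _⟩ := girth k
  have := h v c
  rw [hc] at this
  exact Nat.not_even_iff_odd.2 ho this

/-- for every `α ∈ [0,1]` and `ρ ≥ 2` the bound
`(1 + 1/ρ)(1-α) + 2α` is attained by some graph, bipartizing set, weights and dual. -/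
theorem round_bipartize_arbitrary_set_tight (α : ℝ) (h0 : 0 ≤ α) (h1 : α ≤ 1)
    (ρ : ℕ) (hρ : 2 ≤ ρ) :
    ∃ (n : ℕ) (G : SimpleGraph (Fin n)) (S : Finset (Fin n))
      (w : Fin n → ℝ) (y : Sym2 (Fin n) → ℝ),
      (¬ G.Colorable 2) ∧ (Gdel G ↑S).Colorable 2 ∧
      (¬ (contract G ↑S).Colorable 2) ∧ HasOddGirth (contract G ↑S) (2 * ρ - 1) ∧
      (∀ v, 0 ≤ w v) ∧ (∑ v, w v) = 2 ∧ IsDualCert G w y ∧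
      ysum y (fun e => e ∈ G.edgeSet ∧ ∃ p ∈ S, ∃ q ∈ S, e = s(p, q)) = α ∧
      ∑ v ∈ S, w v + OPT (Gdel G ↑S) w =
        ((1 + 1 / (ρ : ℝ)) * (1 - α) + 2 * α) * OPT G w := by
  obtain ⟨k, rfl⟩ : ∃ k, ρ = k + 2 := ⟨ρ - 2, by omega⟩
  refine ⟨2*(k+3), TG k, TS k, Tw k α, Ty k α, notcol k, delcol k, connotcol k, ?_, ?_, ?_,
    dual k α h0 h1, ysumS k α, ?_⟩
  · exact girth k
  · intro v
    exact Tc_nonneg k α h0 h1 _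
  · rw [wsum, ← mul_one (2:ℝ), ← Tc_sum k α, mul_sum]
    apply sum_congr rfl
    intro i hi
    rw [mem_range] at hi
    rw [chi_one _ _ (by omega) (mem_univ _), chi_one _ _ (by omega) (mem_univ _)]
    ring
  · rw [wS, optDel k α h0 h1, optG k α h0 h1]
    push_cast
    have : (k:ℝ)+2 ≠ 0 := by positivity
    field_simp
    ring
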